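/- Let (H_t)_{t≥0} be a measurable real-valued process with E[|H_t|] < ∞ for all t, and for 0 ≤ s < u let H_{s,u} := σ(H_r : r ≤ s) ∨ σ(H_v : v ≥ u). Then the following two conditions are equivalent: (i) for all 0 ≤ a < b < c < d, E[(H_c − H_b)/(c − b) | H_{a,d}] = (H_d − H_a)/(d − a) almost surely; (ii) for all 0 ≤ s < t < u, E[H_t | H_{s,u}] = ((u−t) H_s + (t−s) H_u)/(u−s) almost surely. -/

import Mathlib

open MeasureTheory ProbabilityTheory Filter Set

/-- The past-future σ-field `σ(H_r : 0 ≤ r ≤ s) ⊔ σ(H_v : v ≥ u)`. -/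
def pastFuture {Ω : Type*} [MeasurableSpace Ω] (H : ℝ → Ω → ℝ) (s u : ℝ) :
    MeasurableSpace Ω :=
  (⨆ r ∈ Set.Icc (0 : ℝ) s, MeasurableSpace.comap (H r) inferInstance) ⊔
    (⨆ v ∈ Set.Ici u, MeasurableSpace.comap (H v) inferInstance)

theorem pastFuture_le {Ω : Type*} [m0 : MeasurableSpace Ω] (H : ℝ → Ω → ℝ)
    (hm : ∀ t, Measurable (H t)) (s u : ℝ) : pastFuture H s u ≤ m0 :=
  sup_le (iSup₂_le fun r _ => (hm r).comap_le) (iSup₂_le fun r _ => (hm r).comap_le)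

theorem pastFuture_anti {Ω : Type*} [MeasurableSpace Ω] (H : ℝ → Ω → ℝ)
    (s u u' : ℝ) (h : u' ≤ u) : pastFuture H s u ≤ pastFuture H s u' :=
  sup_le_sup le_rfl (biSup_mono fun _ hv => le_trans h hv)

theorem measurable_past {Ω : Type*} [MeasurableSpace Ω] (H : ℝ → Ω → ℝ)
    (s u : ℝ) (h : 0 ≤ s) : Measurable[pastFuture H s u] (H s) := by
  apply Measurable.of_comap_le
  exact le_trans (le_iSup₂_of_le (f := fun r (_ : r ∈ Set.Icc (0 : ℝ) s) =>
    MeasurableSpace.comap (H r) inferInstance) s ⟨h, le_rfl⟩ le_rfl) le_sup_left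

/-- Hammersley's original definition of a harness is equivalent to the affine-process
reformulation: for a measurable integrable process `H`,
(i)  ∀ `0 ≤ a < b < c < d`, `E[(H_c − H_b)/(c − b) | H_{a,d}] = (H_d − H_a)/(d − a)` a.s.
if and only if
(ii) ∀ `0 ≤ s < t < u`, `E[H_t | H_{s,u}] = ((u−t) H_s + (t−s) H_u)/(u−s)` a.s. -/
theorem hammersley_iff_affine
    {Ω : Type*} [MeasurableSpace Ω] (μ : Measure Ω) [IsProbabilityMeasure μ]
    (H : ℝ → Ω → ℝ)
    (hmeas : Measurable fun p : ℝ × Ω => H p.1 p.2)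
    (hint : ∀ t : ℝ, 0 ≤ t → Integrable (H t) μ) :
    (∀ a b c d : ℝ, 0 ≤ a → a < b → b < c → c < d →
        μ[fun ω => (H c ω - H b ω) / (c - b) | pastFuture H a d] =ᵐ[μ]
          fun ω => (H d ω - H a ω) / (d - a)) ↔
      (∀ s t u : ℝ, 0 ≤ s → s < t → t < u →
        μ[H t | pastFuture H s u] =ᵐ[μ]
          fun ω => ((u - t) * H s ω + (t - s) * H u ω) / (u - s)) := by
  have hm : ∀ t, Measurable (H t) := fun t => hmeas.comp measurable_prodMk_left
  constructor
  · intro h s t u hs hst htu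
    have hle := pastFuture_le H hm s u
    obtain ⟨b, hsb, hbt⟩ := exists_between hst
    obtain ⟨c, hbc, hct⟩ := exists_between hbt
    have h1 := h s b c t hs hsb hbc hct
    have h2 := h s b c u hs hsb hbc (hct.trans htu)
    have tower := condExp_condExp_of_le (μ := μ) (f := fun ω => (H c ω - H b ω) / (c - b))
      (pastFuture_anti H s u t htu.le) (pastFuture_le H hm s t)
    have h3 := condExp_congr_ae (m := pastFuture H s u) h1
    have e : (fun ω => (H t ω - H s ω) / (t - s)) = (t - s)⁻¹ • (H t - H s) := by
      ext ω; simp [div_eq_inv_mul]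
    rw [e] at h3
    have h4 := condExp_smul (μ := μ) ((t - s)⁻¹) (H t - H s) (pastFuture H s u)
    have h5 := condExp_sub (hint t (by linarith)) (hint s hs) (pastFuture H s u)
    have h6 : μ[H s | pastFuture H s u] = H s :=
      condExp_of_stronglyMeasurable hle (measurable_past H s u hs).stronglyMeasurable (hint s hs)
    rw [h6] at h5
    filter_upwards [h2, tower, h3, h4, h5] with ω g2 g1 g3 g4 g5
    rw [g3, g4, g2] at g1
    simp only [Pi.smul_apply, Pi.sub_apply, smul_eq_mul] at g1 g5
    rw [g5] at g1
    have p1 : t - s ≠ 0 := by linarith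
    have p2 : u - s ≠ 0 := by linarith
    field_simp at g1 ⊢
    linarith
  · intro h a b c d ha hab hbc hcd
    have h1 := h a b d ha hab (hbc.trans hcd)
    have h2 := h a c d ha (hab.trans hbc) hcd
    have e : (fun ω => (H c ω - H b ω) / (c - b)) = (c - b)⁻¹ • (H c - H b) := by
      ext ω; simp [div_eq_inv_mul]
    rw [e]
    have h4 := condExp_smul (μ := μ) ((c - b)⁻¹) (H c - H b) (pastFuture H a d)
    have h5 := condExp_sub (hint c (by linarith)) (hint b (by linarith)) (pastFuture H a d)
    filter_upwards [h1, h2, h4, h5] with ω g1 g2 g4 g5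
    rw [g4, Pi.smul_apply, g5, Pi.sub_apply, g1, g2, smul_eq_mul]
    have p1 : c - b ≠ 0 := by linarith
    have p2 : d - a ≠ 0 := by linarith
    field_simp
    ring
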